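/- Let α = (φ,σ) be a minimal action of the infinite dihedral group ℤ⋊ℤ₂ on a Cantor set X. If α is not free (i.e., some nonidentity group element has a fixed point), then either σ has a fixed point or φ∘σ has a fixed point. -/

import Mathlib

/-- If `s` conjugates `f` to its inverse, it conjugates every power of `f` to the inverse power. -/
theorem Equiv.Perm.apply_zpow_apply_of_conj_eq_inv {X : Type*} {f s : Equiv.Perm X}
    (hs : ∀ x, s (s x) = x) (h : ∀ x, s (f (s x)) = f⁻¹ x) (m : ℤ) (x : X) :
    s ((f ^ m) x) = (f ^ (-m)) (s x) := by
  have hsf : SemiconjBy s f f⁻¹ := Equiv.ext fun y => by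
    simpa [hs] using h (s y)
  simpa using congrArg (fun g : Equiv.Perm X => g x) (hsf.zpow_right m).eq

/-- A point fixed by a nonzero power of a permutation has a finite orbit. -/
theorem Equiv.Perm.finite_range_zpow_apply {X : Type*} {f : Equiv.Perm X} {n : ℤ} (hn : n ≠ 0)
    {x : X} (hx : (f ^ n) x = x) : (Set.range fun k : ℤ => (f ^ k) x).Finite := by
  refine ((Set.finite_Ico 0 |n|).image fun k : ℤ => (f ^ k) x).subset ?_
  rintro _ ⟨k, rfl⟩
  refine ⟨k % n, ⟨Int.emod_nonneg k hn, Int.emod_lt_abs k hn⟩, ?_⟩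
  conv_rhs => rw [← Int.emod_add_mul_ediv k n]
  simp [zpow_add, zpow_mul, Equiv.Perm.zpow_apply_eq_self_of_apply_eq_self hx]

/-- Dense sets in a nonempty perfect `T₁` space are infinite. -/
theorem Dense.infinite_of_perfectSpace {X : Type*} [TopologicalSpace X] [T1Space X]
    [PerfectSpace X] [Nonempty X] {s : Set X} (hs : Dense s) : s.Infinite := by
  intro hfin
  obtain ⟨x⟩ := ‹Nonempty X›
  have hx : (nhdsWithin x {x}ᶜ).NeBot := by
    simpa [AccPt] using PerfectSpace.univ_preperfect (α := X) x (Set.mem_univ x)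
  refine infinite_of_mem_nhds x Filter.univ_mem ?_
  rwa [← hs.closure_eq, hfin.isClosed.closure_eq]


/-- Let `α = (φ, σ)` be a minimal action of the infinite dihedral group `ℤ ⋊ ℤ₂` on a Cantor
set `X`.  If `α` is not free, then either `σ` or `φ ∘ σ` has at least one fixed point. -/
theorem dihedral_minimal_not_free_fixed_point {X : Type*} [TopologicalSpace X] [CompactSpace X]
    [TopologicalSpace.MetrizableSpace X] [TotallyDisconnectedSpace X] [PerfectSpace X]
    [Nonempty X] (φ σ : X ≃ₜ X)
    (hσ : ∀ x, σ (σ x) = x) (hrel : ∀ x, σ (φ (σ x)) = φ.symm x)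
    (hmin : ∀ x : X,
      Dense {y : X | ∃ (n : ℤ) (i : Bool), y = (φ.toEquiv ^ n) (cond i (σ x) x)})
    (hnotfree : ∃ (n : ℤ) (i : Bool) (x : X),
      (φ.toEquiv ^ n) (cond i (σ x) x) = x ∧ ¬(n = 0 ∧ i = false)) :
    (∃ x : X, σ x = x) ∨ (∃ x : X, φ (σ x) = x) := by
  have hpow := Equiv.Perm.apply_zpow_apply_of_conj_eq_inv (f := φ.toEquiv) (s := σ.toEquiv) hσ hrel
  obtain ⟨n, i, x, hx, hn⟩ := hnotfree
  cases i with
  | false =>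
    have hn0 : n ≠ 0 := by simpa using hn
    have hσx : (φ.toEquiv ^ n) (σ x) = σ x := by
      have h : (φ.toEquiv ^ (-n)) x = x := by
        rw [zpow_neg, Equiv.Perm.inv_eq_iff_eq]
        exact hx.symm
      have h' := hpow (-n) x
      rw [h, neg_neg] at h'
      exact h'.symm
    refine absurd (((Equiv.Perm.finite_range_zpow_apply hn0 hx).union
      (Equiv.Perm.finite_range_zpow_apply hn0 hσx)).subset ?_) (hmin x).infinite_of_perfectSpace
    rintro y ⟨k, i, rfl⟩
    cases i
    exacts [Or.inl ⟨k, rfl⟩, Or.inr ⟨k, rfl⟩]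
  | true =>
    have hσx : σ x = (φ.toEquiv ^ (-n)) x := by
      rw [zpow_neg, Equiv.Perm.eq_inv_iff_eq]
      exact hx
    have hflip (k : ℤ) : σ ((φ.toEquiv ^ (-k)) x) = (φ.toEquiv ^ (k - n)) x := by
      refine (hpow (-k) x).trans ?_
      change (φ.toEquiv ^ (- -k)) (σ x) = _
      rw [hσx, ← Equiv.Perm.mul_apply, ← zpow_add, neg_neg, sub_eq_add_neg]
    obtain ⟨k, rfl | rfl⟩ := Int.even_or_odd' n
    · refine Or.inl ⟨(φ.toEquiv ^ (-k)) x, ?_⟩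
      rw [hflip, show k - 2 * k = -k by ring]
    · refine Or.inr ⟨(φ.toEquiv ^ (-k)) x, ?_⟩
      rw [hflip]
      change φ.toEquiv _ = _
      rw [← Equiv.Perm.mul_apply, ← zpow_one_add, show 1 + (k - (2 * k + 1)) = -k by ring]
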